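/- Let ℓ be a prime, let F be an arbitrary field, and let M = F(t_1, t_2) be the field of rational functions in two independent indeterminates t_1, t_2 over F. Then, inside the group M^×/(M^×)^ℓ, the image of F^× equals the intersection of the image of F(t_1)^× and the image of F(t_2)^×. -/

import Mathlib

/-! Common definitions: mod-ℓ Milnor K-theory, K^×/(K^×)^ℓ, Ω_K, relative algebraic
closure, transcendence degree predicates, discrete valuations, etc. -/

noncomputable section

open scoped TensorProduct

universe u v

/-- The `n`-fold tensor power (over `ℤ`) of the multiplicative group `Kˣ`,
written additively. -/
abbrev MilnorPre (n : ℕ) (K : Type*) [Field K] : Type _ :=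
  PiTensorProduct ℤ (fun _ : Fin n => Additive Kˣ)

/-- The submodule of Steinberg relations: generated by all `a₁ ⊗ ⋯ ⊗ aₙ`
with `aᵢ + aⱼ = 1` for some `i < j`. -/
def SteinbergRel (n : ℕ) (K : Type*) [Field K] : Submodule ℤ (MilnorPre n K) :=
  Submodule.span ℤ
    {x | ∃ a : Fin n → Kˣ,
      (∃ i j : Fin n, i < j ∧ ((a i : K) + (a j : K) = 1)) ∧
        x = PiTensorProduct.tprod ℤ (fun i => Additive.ofMul (a i))}

/-- The `n`-th Milnor K-group `K^M_n(K)`: the quotient of the `n`-fold tensor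
power of `K^×` by the Steinberg relations. -/
abbrev MilnorK (n : ℕ) (K : Type*) [Field K] : Type _ :=
  MilnorPre n K ⧸ SteinbergRel n K

/-- The mod-`ℓ` Milnor K-group `k^M_n(K) = K^M_n(K)/ℓ`. -/
abbrev MilnorKMod (ℓ n : ℕ) (K : Type*) [Field K] : Type _ :=
  MilnorK n K ⧸ LinearMap.range ((ℓ : ℤ) • (LinearMap.id : MilnorK n K →ₗ[ℤ] MilnorK n K))

/-- The symbol `{a₁, …, aₙ}` in `k^M_n(K)`. -/
def milnorSymbol (ℓ : ℕ) {n : ℕ} {K : Type*} [Field K] (a : Fin n → Kˣ) :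
    MilnorKMod ℓ n K :=
  Submodule.Quotient.mk (Submodule.Quotient.mk
    (PiTensorProduct.tprod ℤ (fun i => Additive.ofMul (a i))))

/-- `k^M_1(K) = K^×/(K^×)^ℓ`, written multiplicatively. -/
abbrev K1 (ℓ : ℕ) (K : Type*) [Field K] : Type _ :=
  Kˣ ⧸ (powMonoidHom ℓ : Kˣ →* Kˣ).range

/-- The projection `K^× → K^×/(K^×)^ℓ`. -/
def K1proj (ℓ : ℕ) (K : Type*) [Field K] : Kˣ →* K1 ℓ K :=
  QuotientGroup.mk' _

/-- The subgroup of `Kˣ` consisting of the units lying in an intermediate field `L`. -/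
def fieldUnits {k K : Type*} [Field k] [Field K] [Algebra k K]
    (L : IntermediateField k K) : Subgroup Kˣ where
  carrier := {x : Kˣ | (x : K) ∈ L}
  one_mem' := by simpa using one_mem L
  mul_mem' := by
    intro a b ha hb
    simpa using mul_mem ha hb
  inv_mem' := by
    intro a ha
    simpa using inv_mem (show (a : K) ∈ L from ha)

/-- `Ω_K(L)`: the image of `L^×` in `K^×/(K^×)^ℓ`. -/
def Omega (ℓ : ℕ) {k K : Type*} [Field k] [Field K] [Algebra k K]
    (L : IntermediateField k K) : Subgroup (K1 ℓ K) :=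
  (fieldUnits L).map (K1proj ℓ K)

/-- A subextension `L` of `K|k` is relatively algebraically closed in `K` if every
element of `K` algebraic over `L` lies in `L`. -/
def RelAlgClosed {k K : Type*} [Field k] [Field K] [Algebra k K]
    (L : IntermediateField k K) : Prop :=
  ∀ x : K, IsAlgebraic L x → x ∈ L

/-- `K` is a function field over `k`: a finitely generated field extension. -/
def IsFunctionField (k K : Type*) [Field k] [Field K] [Algebra k K] : Prop :=
  ∃ s : Finset K, IntermediateField.adjoin k (s : Set K) = ⊤

/-- `trdeg(K|k) = d`: there is a transcendence basis indexed by `Fin d`. -/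
def HasTrdeg (k : Type*) (K : Type*) [Field k] [Field K] [Algebra k K] (d : ℕ) : Prop :=
  ∃ x : Fin d → K, IsTranscendenceBasis k x

/-- `trdeg(K|k) ≥ m`: there are `m` algebraically independent elements. -/
def TrdegGe (k : Type*) (K : Type*) [Field k] [Field K] [Algebra k K] (m : ℕ) : Prop :=
  ∃ x : Fin m → K, AlgebraicIndependent k x

/-- `dim^M_K(S) ≥ d` for a subset `S ⊆ k^M_1(K)`: there are `s₁, …, s_d ∈ S` with
`{s₁, …, s_d} ≠ 0` in `k^M_d(K)`. -/
def dimMge (ℓ : ℕ) {K : Type*} [Field K] (S : Set (K1 ℓ K)) (d : ℕ) : Prop :=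
  ∃ a : Fin d → Kˣ, (∀ i, K1proj ℓ K (a i) ∈ S) ∧ milnorSymbol ℓ a ≠ 0

/-- `dim^M_K(S) = r`. -/
def dimMeq (ℓ : ℕ) {K : Type*} [Field K] (S : Set (K1 ℓ K)) (r : ℕ) : Prop :=
  dimMge ℓ S r ∧ ¬ dimMge ℓ S (r + 1)

/-- `t` is a general element of `K` over `k`: `t ∉ k` and `k(t)` is relatively
algebraically closed in `K`. -/
def IsGeneralElement (k : Type*) {K : Type*} [Field k] [Field K] [Algebra k K] (t : K) : Prop :=
  t ∉ (⊥ : IntermediateField k K) ∧ RelAlgClosed (IntermediateField.adjoin k {t})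

/-- A rational subgroup of `k^M_1(K)`: `Ω_K(k(t))` for a general element `t`. -/
def IsRationalSubgroup (ℓ : ℕ) (k : Type*) {K : Type*} [Field k] [Field K] [Algebra k K]
    (A : Subgroup (K1 ℓ K)) : Prop :=
  ∃ t : K, IsGeneralElement k t ∧ A = Omega ℓ (IntermediateField.adjoin k {t})

/-- `𝔊^r(K|k)`: the subgroups `Ω_K(L)` for `L` relatively algebraically closed
in `K` of transcendence degree `r` over `k`. -/
def GSet (ℓ : ℕ) (k : Type*) {K : Type*} [Field k] [Field K] [Algebra k K] (r : ℕ) :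
    Set (Subgroup (K1 ℓ K)) :=
  {A | ∃ L : IntermediateField k K, RelAlgClosed L ∧ HasTrdeg k L r ∧ A = Omega ℓ L}

/-- `𝔐^1(K)`: subgroups maximal among the subgroups `B` of `k^M_1(K)`
with `dim^M_K(B) = 1`. -/
def M1Set (ℓ : ℕ) (K : Type*) [Field K] : Set (Subgroup (K1 ℓ K)) :=
  {A | dimMeq ℓ (A : Set (K1 ℓ K)) 1 ∧
    ∀ B : Subgroup (K1 ℓ K), dimMeq ℓ (B : Set (K1 ℓ K)) 1 → A ≤ B → B = A}

/-- Condition (a) and (b) of the maximality characterization of `𝔊^r`: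
`B` is generated by rational subgroups and `dim^M_K(B) = r`. -/
def SpannedByRatWithDim (ℓ : ℕ) (k : Type*) {K : Type*} [Field k] [Field K] [Algebra k K]
    (r : ℕ) (B : Subgroup (K1 ℓ K)) : Prop :=
  (∃ S : Set (Subgroup (K1 ℓ K)), (∀ T ∈ S, IsRationalSubgroup ℓ k T) ∧ B = sSup S) ∧
    dimMeq ℓ (B : Set (K1 ℓ K)) r

/-- A discrete valuation of a field `F`: a surjective homomorphism `F^× → ℤ`
satisfying the ultrametric inequality. -/
structure DiscreteValuation (F : Type*) [Field F] where
  v : Fˣ → ℤ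
  map_mul' : ∀ x y : Fˣ, v (x * y) = v x + v y
  surjective' : Function.Surjective v
  min_le' : ∀ x y z : Fˣ, (x : F) + (y : F) = (z : F) → min (v x) (v y) ≤ v z

lemma DiscreteValuation.v_one {F : Type*} [Field F] (w : DiscreteValuation F) : w.v 1 = 0 := by
  have h := w.map_mul' 1 1
  simp only [mul_one] at h
  omega

/-- A discrete valuation of `F` is trivial on the base field `k`. -/
def DiscreteValuation.TrivialOn (k : Type*) {F : Type*} [Field k] [Field F] [Algebra k F]
    (w : DiscreteValuation F) : Prop :=
  ∀ (c : k) (hc : algebraMap k F c ≠ 0), w.v (Units.mk0 _ hc) = 0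

/-- The unit group `U_w ⊆ F^×` of a discrete valuation. -/
def DiscreteValuation.units {F : Type*} [Field F] (w : DiscreteValuation F) : Subgroup Fˣ where
  carrier := {x : Fˣ | w.v x = 0}
  one_mem' := w.v_one
  mul_mem' := by
    intro a b ha hb
    have h := w.map_mul' a b
    simp only [Set.mem_setOf_eq] at ha hb ⊢
    omega
  inv_mem' := by
    intro a ha
    have h := w.map_mul' a a⁻¹
    rw [mul_inv_cancel] at h
    have h1 := w.v_one
    simp only [Set.mem_setOf_eq] at ha ⊢
    omega

/-- `𝔘_v`: the image of the unit group `U_v` in `K^×/(K^×)^ℓ`. -/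
def DiscreteValuation.unitsImage (ℓ : ℕ) {F : Type*} [Field F] (w : DiscreteValuation F) :
    Subgroup (K1 ℓ F) :=
  w.units.map (K1proj ℓ F)

/-- For a discrete valuation `w` of an intermediate field `F` of `K|k`, the image of
the unit group `U_w` in `K^×/(K^×)^ℓ`. -/
def unitsImageIn (ℓ : ℕ) {k K : Type*} [Field k] [Field K] [Algebra k K]
    (F : IntermediateField k K) (w : DiscreteValuation F) : Subgroup (K1 ℓ K) :=
  (w.units.map (Units.map (algebraMap F K).toMonoidHom)).map (K1proj ℓ K)

/-- The residue field of `v` has transcendence degree `≥ m` over `k`: there are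
`v`-units `x₁, …, x_m` whose residues are algebraically independent over `k`,
expressed by saying that every nonzero polynomial over `k` evaluated at the `xᵢ`
is a unit of value `0`. -/
def DiscreteValuation.ResidueTrdegGe (k : Type*) {K : Type*} [Field k] [Field K] [Algebra k K]
    (v : DiscreteValuation K) (m : ℕ) : Prop :=
  ∃ x : Fin m → Kˣ, (∀ i, v.v (x i) = 0) ∧
    ∀ P : MvPolynomial (Fin m) k, P ≠ 0 →
      ∃ u : Kˣ, (u : K) = MvPolynomial.aeval (fun i => ((x i : K))) P ∧ v.v u = 0

/-- A divisorial-type valuation of `K|k` (where `d = trdeg(K|k)`): a discrete valuation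
trivial on `k` whose residue field has transcendence degree exactly `d - 1` over `k`. -/
def IsDivisorialType (k : Type*) {K : Type*} [Field k] [Field K] [Algebra k K] (d : ℕ)
    (v : DiscreteValuation K) : Prop :=
  v.TrivialOn k ∧ v.ResidueTrdegGe k (d - 1) ∧ ¬ v.ResidueTrdegGe k d

/-- `Δ_A`: the set of subgroups `A ⊓ 𝔘_v`, for `v` ranging over the divisorial-type
valuations of `K` with `A ⊄ 𝔘_v`. -/
def DeltaA (ℓ : ℕ) (k : Type*) {K : Type*} [Field k] [Field K] [Algebra k K] (d : ℕ)
    (A : Subgroup (K1 ℓ K)) : Set (Subgroup (K1 ℓ K)) :=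
  {T | ∃ v : DiscreteValuation K, IsDivisorialType k d v ∧
    ¬ A ≤ v.unitsImage ℓ ∧ T = A ⊓ v.unitsImage ℓ}

/-- A good rational subgroup: a rational subgroup `A = Ω_K(k(t))` such that for every
discrete valuation `w` of `k(t)` trivial on `k`, the image of `U_w` in `K^×/(K^×)^ℓ`
belongs to `Δ_A`. -/
def IsGoodRationalSubgroup (ℓ : ℕ) (k : Type*) {K : Type*} [Field k] [Field K] [Algebra k K]
    (d : ℕ) (A : Subgroup (K1 ℓ K)) : Prop :=
  ∃ t : K, IsGeneralElement k t ∧ A = Omega ℓ (IntermediateField.adjoin k {t}) ∧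
    ∀ w : DiscreteValuation (IntermediateField.adjoin k {t}), w.TrivialOn k →
      unitsImageIn ℓ (IntermediateField.adjoin k {t}) w ∈ DeltaA ℓ k d A

/-- A very general element: a general element `t` such that `Ω_K(k(t))` is a good
rational subgroup. -/
def IsVeryGeneral (ℓ : ℕ) (k : Type*) {K : Type*} [Field k] [Field K] [Algebra k K]
    (d : ℕ) (t : K) : Prop :=
  IsGeneralElement k t ∧ IsGoodRationalSubgroup ℓ k d (Omega ℓ (IntermediateField.adjoin k {t}))

/-- `x` is separable in `K`: in characteristic `p > 0`, `x` is not a `p`-th power;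
in characteristic `0` every element is separable. -/
def IsSeparableIn (K : Type*) [Field K] (x : K) : Prop :=
  ∀ p : ℕ, p.Prime → CharP K p → ¬ ∃ y : K, y ^ p = x

/-- A perfect closure of `K`: a perfect field which is a purely inseparable
extension of `K`. -/
structure PerfectClosureOf (K : Type u) [Field K] : Type (u + 1) where
  carrier : Type u
  [fieldInst : Field carrier]
  [algebraInst : Algebra K carrier]
  purelyInseparable : IsPurelyInseparable K carrier
  perfect : PerfectField carrier

attribute [instance] PerfectClosureOf.fieldInst PerfectClosureOf.algebraInst

/-- A group isomorphism `φ : k^M_1(K) → k^M_1(L)` is induced by a field isomorphism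
`σ : K^i → L^i` of the perfect closures, via the canonical identifications
`k^M_1(K) ≅ k^M_1(K^i)` and `k^M_1(L) ≅ k^M_1(L^i)`. -/
def InducesOnK1 (ℓ : ℕ) {K : Type u} {L : Type v} [Field K] [Field L]
    (PK : PerfectClosureOf K) (PL : PerfectClosureOf L)
    (σ : PK.carrier ≃+* PL.carrier) (φ : K1 ℓ K ≃* K1 ℓ L) : Prop :=
  ∀ (x : Kˣ) (y : Lˣ),
    (φ (K1proj ℓ K x) = K1proj ℓ L y ↔
      ∃ z : (PL.carrier)ˣ,
        Units.map σ.toRingHom.toMonoidHom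
            (Units.map (algebraMap K PK.carrier).toMonoidHom x) =
          Units.map (algebraMap L PL.carrier).toMonoidHom y * z ^ ℓ)

/-- `φ : k^M_1(K) → k^M_1(L)` is compatible with `k^M_2`: `φ ⊗ φ` descends, along the
multiplication maps, to an isomorphism `k^M_2(K) → k^M_2(L)`; equivalently, there is an
additive isomorphism `k^M_2(K) ≃ k^M_2(L)` carrying `{a, b}` to `{a', b'}` whenever
`φ` carries the class of `a` (resp. `b`) to the class of `a'` (resp. `b'`). -/
def CompatWithK2 (ℓ : ℕ) {K L : Type*} [Field K] [Field L] (φ : K1 ℓ K ≃* K1 ℓ L) : Prop :=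
  ∃ ψ : MilnorKMod ℓ 2 K ≃+ MilnorKMod ℓ 2 L,
    ∀ (a b : Kˣ) (a' b' : Lˣ),
      φ (K1proj ℓ K a) = K1proj ℓ L a' → φ (K1proj ℓ K b) = K1proj ℓ L b' →
        ψ (milnorSymbol ℓ ![a, b]) = milnorSymbol ℓ ![a', b']

/-- `φ : k^M_1(K) → k^M_1(L)` is compatible with `𝔊^1_rat`: it maps rational subgroups
bijectively onto rational subgroups. -/
def CompatWithRat (ℓ : ℕ) (k : Type*) (l : Type*) {K L : Type*}
    [Field k] [Field K] [Algebra k K] [Field l] [Field L] [Algebra l L]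
    (φ : K1 ℓ K ≃* K1 ℓ L) : Prop :=
  (∀ A : Subgroup (K1 ℓ K), IsRationalSubgroup ℓ k A →
     IsRationalSubgroup ℓ l (A.map φ.toMonoidHom)) ∧
  (∀ B : Subgroup (K1 ℓ L), IsRationalSubgroup ℓ l B →
     ∃ A : Subgroup (K1 ℓ K), IsRationalSubgroup ℓ k A ∧ A.map φ.toMonoidHom = B)

/-- Two isomorphisms of perfect closures differ by a power of the Frobenius
(in characteristic `0`, they are equal). -/
def FrobTwistEquiv {Ki Li : Type*} [Field Ki] [Field Li] (σ σ' : Ki ≃+* Li) : Prop :=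
  σ = σ' ∨ ∃ p : ℕ, p.Prime ∧ CharP Ki p ∧
    ((∃ n : ℕ, ∀ x, σ' x = σ (x ^ p ^ n)) ∨ (∃ n : ℕ, ∀ x, σ x = σ' (x ^ p ^ n)))

/-- The leading coefficient of a polynomial in two variables with respect to the variable `X 0`,
as a polynomial in the remaining variable `X 1`. -/
def leadingCoeffZero (F : Type*) [Field F] :
    MvPolynomial (Fin 2) F →* MvPolynomial (Fin 2) F :=
  (MvPolynomial.rename Fin.succ : MvPolynomial (Fin 1) F →ₐ[F] _).toRingHom.toMonoidHom.comp
    ((Polynomial.leadingCoeffHom (R := MvPolynomial (Fin 1) F)).comp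
      (MvPolynomial.finSuccEquiv F 1).toRingEquiv.toRingHom.toMonoidHom)

lemma leadingCoeffZero_apply {F : Type*} [Field F] (p : MvPolynomial (Fin 2) F) :
    leadingCoeffZero F p =
      MvPolynomial.rename Fin.succ (MvPolynomial.finSuccEquiv F 1 p).leadingCoeff :=
  rfl

lemma leadingCoeffZero_ne_zero {F : Type*} [Field F] {p : MvPolynomial (Fin 2) F} (hp : p ≠ 0) :
    leadingCoeffZero F p ≠ 0 := by
  rw [leadingCoeffZero_apply, Ne,
    map_eq_zero_iff _ (MvPolynomial.rename_injective _ (Fin.succ_injective 1)),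
    Polynomial.leadingCoeff_eq_zero]
  simpa using hp

lemma leadingCoeffZero_aeval_X_zero {F : Type*} [Field F] (p : Polynomial F) :
    leadingCoeffZero F (Polynomial.aeval (MvPolynomial.X 0) p) =
      MvPolynomial.C p.leadingCoeff := by
  have h : MvPolynomial.finSuccEquiv F 1 (Polynomial.aeval (MvPolynomial.X 0) p) =
      p.map MvPolynomial.C := by
    rw [← Polynomial.aeval_algHom_apply, MvPolynomial.finSuccEquiv_X_zero]
    exact Polynomial.aeval_X_left_eq_map p
  rw [leadingCoeffZero_apply, h,
    Polynomial.leadingCoeff_map_of_injective (MvPolynomial.C_injective _ _),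
    MvPolynomial.rename_C]

lemma leadingCoeffZero_aeval_X_one {F : Type*} [Field F] (p : Polynomial F) :
    leadingCoeffZero F (Polynomial.aeval (MvPolynomial.X 1) p) =
      Polynomial.aeval (MvPolynomial.X 1) p := by
  have h : MvPolynomial.finSuccEquiv F 1 (Polynomial.aeval (MvPolynomial.X 1) p) =
      Polynomial.C (Polynomial.aeval (MvPolynomial.X 0) p) := by
    rw [← Polynomial.aeval_algHom_apply,
      show (1 : Fin 2) = Fin.succ 0 from rfl, MvPolynomial.finSuccEquiv_X_succ]
    exact Polynomial.aeval_algHom_apply (Polynomial.CAlgHom (R := F)) _ p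
  rw [leadingCoeffZero_apply, h, Polynomial.leadingCoeff_C, ← Polynomial.aeval_algHom_apply,
    MvPolynomial.rename_X]
  rfl

lemma Omega_mono (ℓ : ℕ) {k K : Type*} [Field k] [Field K] [Algebra k K]
    {L L' : IntermediateField k K} (h : L ≤ L') : Omega ℓ L ≤ Omega ℓ L' :=
  Subgroup.map_mono fun _ hx => h hx

lemma K1proj_eq_iff {ℓ : ℕ} {K : Type*} [Field K] {x y : Kˣ} :
    K1proj ℓ K x = K1proj ℓ K y ↔ ∃ w : Kˣ, y = x * w ^ ℓ := by
  refine QuotientGroup.eq.trans ⟨?_, ?_⟩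
  · rintro ⟨w, hw⟩
    exact ⟨w, by simp [show w ^ ℓ = x⁻¹ * y from hw]⟩
  · rintro ⟨w, rfl⟩
    exact ⟨w, by simp⟩

/-- If `x ∈ F(t₀)` and `y ∈ F(t₁)` differ by an `ℓ`-th power in `F(t₀, t₁)`, then `y` is a constant
times an `ℓ`-th power. -/
lemma exists_eq_algebraMap_mul_pow {ℓ : ℕ} {F M : Type*} [Field F] [Field M] [Algebra F M]
    {t : Fin 2 → M} (hind : AlgebraicIndependent F t)
    (hgen : IntermediateField.adjoin F (Set.range t) = ⊤) {x y w : M}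
    (hx : x ∈ IntermediateField.adjoin F {t 0}) (hy : y ∈ IntermediateField.adjoin F {t 1})
    (hx0 : x ≠ 0) (hy0 : y ≠ 0) (hw0 : w ≠ 0) (h : y = x * w ^ ℓ) :
    ∃ (c : F) (z : M), z ≠ 0 ∧ y = algebraMap F M c * z ^ ℓ := by
  obtain ⟨a, b, rfl⟩ := (IntermediateField.mem_adjoin_simple_iff F x).mp hx
  obtain ⟨c, d, rfl⟩ := (IntermediateField.mem_adjoin_simple_iff F y).mp hy
  obtain ⟨P, Q, rfl⟩ := (IntermediateField.mem_adjoin_range_iff F t w).mp (hgen ▸ trivial)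
  obtain ⟨ha, hb⟩ := div_ne_zero_iff.mp hx0
  obtain ⟨hc, hd⟩ := div_ne_zero_iff.mp hy0
  obtain ⟨hP, hQ⟩ := div_ne_zero_iff.mp hw0
  have aeval_X (i : Fin 2) (p : Polynomial F) :
      MvPolynomial.aeval t (Polynomial.aeval (MvPolynomial.X i : MvPolynomial (Fin 2) F) p) =
        Polynomial.aeval (t i) p := by
    rw [← Polynomial.aeval_algHom_apply, MvPolynomial.aeval_X]
  have key : Polynomial.aeval (MvPolynomial.X 1) c * Polynomial.aeval (MvPolynomial.X 0) b * Q ^ ℓ =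
      Polynomial.aeval (MvPolynomial.X 0) a * Polynomial.aeval (MvPolynomial.X 1) d * P ^ ℓ := by
    apply hind
    simp only [map_mul, map_pow, aeval_X]
    rw [div_pow] at h
    field_simp at h
    linear_combination h
  have hlead := congrArg (fun p => MvPolynomial.aeval t (leadingCoeffZero F p)) key
  simp only [map_mul, map_pow, leadingCoeffZero_aeval_X_zero, leadingCoeffZero_aeval_X_one,
    aeval_X, MvPolynomial.aeval_C] at hlead
  have lead_ne {p : MvPolynomial (Fin 2) F} (hp : MvPolynomial.aeval t p ≠ 0) :
      MvPolynomial.aeval t (leadingCoeffZero F p) ≠ 0 := by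
    rw [Ne, map_eq_zero_iff _ hind]
    exact leadingCoeffZero_ne_zero fun h0 => hp (by rw [h0, map_zero])
  have hP' := lead_ne hP
  have hQ' := lead_ne hQ
  have hb' : algebraMap F M b.leadingCoeff ≠ 0 := by
    rw [Ne, map_eq_zero, Polynomial.leadingCoeff_eq_zero]
    rintro rfl
    exact hb (map_zero _)
  refine ⟨a.leadingCoeff / b.leadingCoeff, _, div_ne_zero hP' hQ', ?_⟩
  rw [map_div₀, div_pow]
  field_simp
  linear_combination hlead

theorem statement_9 (ℓ : ℕ) (hℓ : ℓ.Prime) (F M : Type*) [Field F] [Field M] [Algebra F M]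
    (t : Fin 2 → M) (hind : AlgebraicIndependent F t)
    (hgen : IntermediateField.adjoin F (Set.range t) = ⊤) :
    Omega ℓ (⊥ : IntermediateField F M) =
      Omega ℓ (IntermediateField.adjoin F {t 0}) ⊓ Omega ℓ (IntermediateField.adjoin F {t 1}) := by
  apply le_antisymm
  · exact le_inf (Omega_mono ℓ bot_le) (Omega_mono ℓ bot_le)
  · rintro _ ⟨⟨x, hx, rfl⟩, ⟨y, hy, hyx⟩⟩
    obtain ⟨w, hw⟩ := K1proj_eq_iff.mp hyx.symm
    obtain ⟨c, z, hz, hyz⟩ := exists_eq_algebraMap_mul_pow (ℓ := ℓ) hind hgen hx hy x.ne_zero y.ne_zero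
      w.ne_zero (by rw [hw]; simp)
    have hc : algebraMap F M c ≠ 0 := left_ne_zero_of_mul (hyz ▸ y.ne_zero)
    refine ⟨Units.mk0 _ hc, IntermediateField.algebraMap_mem (⊥ : IntermediateField F M) c, ?_⟩
    rw [← hyx, K1proj_eq_iff]
    exact ⟨Units.mk0 z hz, Units.ext (by simpa using hyz)⟩

end
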